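/- Let C be a clutter on n vertices with m edges, incidence matrix M, edge ideal I, and for c ∈ Z_{≥0}^n let γ(c) = min{ c·x : x ∈ Z_{≥0}^n, Mᵀx ≥ 1_m } and σ(c) = max{ 1_m·y : y ∈ Z_{≥0}^m, My ≤ c }. If γ(c) = σ(c) for every c ∈ Z_{≥0}^n with c ≤ ⌈m/2⌉·(1,...,1) componentwise, then γ(c) = σ(c) for every c ∈ Z_{≥0}^n, i.e., C has the Max-Flow-Min-Cut property. -/

import Mathlib

section Superadditive

variable {A : Type*} [AddCommMonoid A]

/-- A superadditive, positively homogeneous function of bounded increments. -/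
structure IsSuperlinear (φ : A → ℕ) : Prop where
  add_le : ∀ a b, φ a + φ b ≤ φ (a + b)
  nsmul : ∀ (N : ℕ) a, φ (N • a) = N * φ a
  bounded : ∀ b, ∃ L, ∀ a, φ (a + b) ≤ φ a + L

/-- `φ` is additive in the direction `d`. -/
def AdditiveAlong (φ : A → ℕ) (d : A) : Prop :=
  ∀ a, φ (a + d) = φ a + φ d

theorem exists_eventually_eq_of_monotone_of_le {f : ℕ → ℕ} (hf : Monotone f) {B : ℕ}
    (hB : ∀ k, f k ≤ B) : ∃ v N₀, ∀ N ≥ N₀, f N = v := by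
  have hfin : (Set.range f).Finite :=
    (Set.finite_Iic B).subset (by rintro _ ⟨k, rfl⟩; exact hB k)
  obtain ⟨_, ⟨N₀, rfl⟩, hmax⟩ := Set.exists_max_image _ id hfin (Set.range_nonempty f)
  exact ⟨f N₀, N₀, fun N hN => le_antisymm (hmax _ ⟨N, rfl⟩) (hf hN)⟩

namespace IsSuperlinear

variable {φ : A → ℕ}

theorem map_zero (hφ : IsSuperlinear φ) : φ 0 = 0 := by
  simpa using hφ.nsmul 0 0

/-- The directional derivative of `φ` at `d` exists. -/
theorem exists_eventually_eq (hφ : IsSuperlinear φ) (d a : A) :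
    ∃ v N₀, ∀ N ≥ N₀, φ (a + N • d) = v + N * φ d := by
  have hle : ∀ N, N * φ d ≤ φ (a + N • d) := fun N => by
    have := hφ.add_le a (N • d)
    rw [hφ.nsmul] at this
    omega
  obtain ⟨L, hL⟩ := hφ.bounded a
  have hmono : Monotone fun N => φ (a + N • d) - N * φ d := by
    refine monotone_nat_of_le_succ fun N => ?_
    have := hφ.add_le (a + N • d) d
    have e : a + N • d + d = a + (N + 1) • d := by rw [succ_nsmul, add_assoc]
    rw [e] at this
    have := hle N
    have : (N + 1) * φ d = N * φ d + φ d := by ring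
    omega
  obtain ⟨v, N₀, h⟩ := exists_eventually_eq_of_monotone_of_le hmono (B := L) fun N => by
    have := hL (N • d)
    rw [hφ.nsmul, add_comm] at this
    omega
  refine ⟨v, N₀, fun N hN => ?_⟩
  have := h N hN
  have := hle N
  omega

/-- Passing to the directional derivative at `d` makes a superlinear function additive along `d`. -/
theorem exists_additiveAlong (hφ : IsSuperlinear φ) (d : A) :
    ∃ ψ : A → ℕ, IsSuperlinear ψ ∧ φ ≤ ψ ∧ AdditiveAlong ψ d ∧ ψ d = φ d ∧
      ∀ e, AdditiveAlong φ e → AdditiveAlong ψ e ∧ ψ e = φ e := by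
  choose ψ K hψ using hφ.exists_eventually_eq d
  have hψd : ψ d = φ d := by
    have h := hψ d (K d) le_rfl
    have e : d + K d • d = (K d + 1) • d := by rw [succ_nsmul, add_comm]
    rw [e, hφ.nsmul] at h
    linarith
  refine ⟨ψ, ⟨fun a b => ?_, fun N a => ?_, fun b => ?_⟩, fun a => ?_, fun a => ?_, hψd,
    fun e he => ?_⟩
  · let N := K a + K b + K (a + b)
    have ha := hψ a N (by omega)
    have hb := hψ b N (by omega)
    have hab := hψ (a + b) (N + N) (by omega)
    have h := hφ.add_le (a + N • d) (b + N • d)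
    have e : a + N • d + (b + N • d) = a + b + (N + N) • d := by
      rw [add_nsmul d N N, add_add_add_comm]
    rw [e] at h
    linarith
  · rcases Nat.eq_zero_or_pos N with rfl | hN
    · have h := hψ 0 (K 0) le_rfl
      rw [zero_add, hφ.nsmul] at h
      simp only [zero_nsmul, zero_mul]
      omega
    · let k := K a + K (N • a)
      have ha := hψ a k (by omega)
      have hNa := hψ (N • a) (N * k) (by
        have : 1 * k ≤ N * k := Nat.mul_le_mul_right _ hN
        omega)
      have e : N • a + (N * k) • d = N • (a + k • d) := by rw [mul_nsmul', nsmul_add]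
      rw [e, hφ.nsmul, ha] at hNa
      linarith
  · obtain ⟨L, hL⟩ := hφ.bounded b
    refine ⟨L, fun a => ?_⟩
    let N := K a + K (a + b)
    have ha := hψ a N (by omega)
    have hab := hψ (a + b) N (by omega)
    have h := hL (a + N • d)
    have e : a + N • d + b = a + b + N • d := by abel
    rw [e] at h
    linarith
  · have ha := hψ a (K a) le_rfl
    have h := hφ.add_le a (K a • d)
    rw [hφ.nsmul] at h
    change φ a ≤ ψ a
    linarith
  · let N := K a + K (a + d)
    have ha := hψ a (N + 1) (by omega)
    have had := hψ (a + d) N (by omega)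
    have e : a + d + N • d = a + (N + 1) • d := by rw [succ_nsmul]; abel
    rw [e, ha] at had
    linarith
  · have key : ∀ a, ψ (a + e) = ψ a + φ e := fun a => by
      let N := K a + K (a + e)
      have ha := hψ a N (by omega)
      have hae := hψ (a + e) N (by omega)
      have h := he (a + N • d)
      have e' : a + N • d + e = a + e + N • d := by abel
      rw [e'] at h
      linarith
    have h0 : ψ 0 = 0 := by
      have h := hψ 0 (K 0) le_rfl
      rw [zero_add, hφ.nsmul] at h
      omega
    have hψe : ψ e = φ e := by simpa [h0] using key 0
    exact ⟨fun a => by rw [key, hψe], hψe⟩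

theorem exists_additiveAlong_finset (hφ : IsSuperlinear φ) (s : Finset A) :
    ∃ ψ : A → ℕ, IsSuperlinear ψ ∧ φ ≤ ψ ∧ (∀ d ∈ s, AdditiveAlong ψ d) ∧
      ∀ e, AdditiveAlong φ e → AdditiveAlong ψ e ∧ ψ e = φ e := by
  classical
  induction s using Finset.induction_on with
  | empty => exact ⟨φ, hφ, le_rfl, by simp, fun e he => ⟨he, rfl⟩⟩
  | insert d s _ ih =>
    obtain ⟨ψ, hψ, hle, hs, hadd⟩ := ih
    obtain ⟨χ, hχ, hle', hd, -, hadd'⟩ := hψ.exists_additiveAlong d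
    refine ⟨χ, hχ, hle.trans hle', fun e he => ?_, fun e he => ?_⟩
    · rcases Finset.mem_insert.1 he with rfl | he
      · exact hd
      · exact (hadd' e (hs e he)).1
    · obtain ⟨h1, h2⟩ := hadd e he
      exact ⟨(hadd' e h1).1, (hadd' e h1).2.trans h2⟩

end IsSuperlinear

end Superadditive

/-- An integral superlinear function on `ℕⁿ` has an integral linear majorant that agrees with it at
a given point. -/
theorem IsSuperlinear.exists_linear_majorant {n : ℕ} {φ : (Fin n → ℕ) → ℕ}
    (hφ : IsSuperlinear φ) (c : Fin n → ℕ) :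
    ∃ x : Fin n → ℕ, (∀ a, φ a ≤ ∑ i, a i * x i) ∧ φ c = ∑ i, c i * x i := by
  obtain ⟨χ, hχ, hφχ, hc, hχc, -⟩ := hφ.exists_additiveAlong c
  obtain ⟨ψ, hψ, hχψ, hs, hadd⟩ := hχ.exists_additiveAlong_finset
    (Finset.univ.image fun i : Fin n => (Pi.single i 1 : Fin n → ℕ))
  have hsingle : ∀ (i : Fin n) (k : ℕ) (a : Fin n → ℕ),
      ψ (a + Pi.single i k) = ψ a + k * ψ (Pi.single i 1) := by
    intro i k
    induction k with
    | zero => simp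
    | succ k ih =>
      intro a
      have h := hs (Pi.single i 1) (by simp)
      rw [Pi.single_add, ← add_assoc, h, ih]
      ring
  have hsum : ∀ (s : Finset (Fin n)) (a : Fin n → ℕ),
      ψ (∑ i ∈ s, Pi.single i (a i)) = ∑ i ∈ s, a i * ψ (Pi.single i 1) := by
    intro s a
    induction s using Finset.induction_on with
    | empty => simpa using hψ.map_zero
    | insert i s hi ih => rw [Finset.sum_insert hi, Finset.sum_insert hi, add_comm, hsingle, ih,
        add_comm]
  have hlin : ∀ a, ψ a = ∑ i, a i * ψ (Pi.single i 1) := fun a => by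
    simpa [Finset.univ_sum_single] using hsum Finset.univ a
  refine ⟨fun i => ψ (Pi.single i 1), fun a => ?_, ?_⟩
  · rw [← hlin]
    exact (hφχ a).trans (hχψ a)
  · rw [← hlin, (hadd c hc).2, hχc]

section Packing

variable {n m : ℕ} {M : Matrix (Fin n) (Fin m) ℕ}

/-- `y` is an integral packing of the columns of `M` within the capacities `c`. -/
def IsPacking (M : Matrix (Fin n) (Fin m) ℕ) (c : Fin n → ℕ) (y : Fin m → ℕ) : Prop :=
  ∀ i, ∑ j, M i j * y j ≤ c i

/-- `x` is an integral cover of the columns of `M`. -/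
def IsCover (M : Matrix (Fin n) (Fin m) ℕ) (x : Fin n → ℕ) : Prop :=
  ∀ j, 1 ≤ ∑ i, M i j * x i

theorem IsPacking.add {a b : Fin n → ℕ} {y z : Fin m → ℕ} (hy : IsPacking M a y)
    (hz : IsPacking M b z) : IsPacking M (a + b) (y + z) := fun i => by
  simp only [Pi.add_apply, mul_add, Finset.sum_add_distrib]
  exact add_le_add (hy i) (hz i)

theorem IsCover.sum_le {x : Fin n → ℕ} (hx : IsCover M x) {c : Fin n → ℕ} {y : Fin m → ℕ}
    (hy : IsPacking M c y) : ∑ j, y j ≤ ∑ i, c i * x i :=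
  calc ∑ j, y j ≤ ∑ j, (∑ i, M i j * x i) * y j :=
        Finset.sum_le_sum fun j _ => Nat.le_mul_of_pos_left _ (hx j)
    _ = ∑ i, (∑ j, M i j * y j) * x i := by
        simp only [Finset.sum_mul]
        rw [Finset.sum_comm]
        exact Finset.sum_congr rfl fun i _ => Finset.sum_congr rfl fun j _ => by ring
    _ ≤ ∑ i, c i * x i := Finset.sum_le_sum fun i _ => Nat.mul_le_mul_right _ (hy i)

theorem isCover_one (hedge : ∀ j, ∃ i, M i j = 1) : IsCover M 1 := fun j => by
  obtain ⟨i, hi⟩ := hedge j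
  calc 1 = M i j * (1 : Fin n → ℕ) i := by simp [hi]
    _ ≤ _ := Finset.single_le_sum (f := fun i => M i j * (1 : Fin n → ℕ) i)
      (fun _ _ => Nat.zero_le _) (Finset.mem_univ i)

/-- One more unit of capacity increases the size of a packing by at most one. -/
theorem IsPacking.exists_of_add_single (hM : ∀ i j, M i j ≤ 1) {a : Fin n → ℕ} {i : Fin n}
    {y : Fin m → ℕ} (hy : IsPacking M (a + Pi.single i 1) y) :
    ∃ z, IsPacking M a z ∧ ∑ j, y j ≤ ∑ j, z j + 1 := by
  by_cases hi : ∑ j, M i j * y j ≤ a i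
  · refine ⟨y, fun k => ?_, by omega⟩
    by_cases hk : k = i
    · exact hk ▸ hi
    · simpa [Pi.single_eq_of_ne hk] using hy k
  · have hpos : ∑ j, M i j * y j ≠ 0 := by omega
    obtain ⟨j, -, hj⟩ := Finset.exists_ne_zero_of_sum_ne_zero hpos
    have hMij : M i j = 1 := by
      have := hM i j
      have := left_ne_zero_of_mul hj
      omega
    have hyj : y j ≠ 0 := right_ne_zero_of_mul hj
    obtain ⟨z, rfl⟩ : ∃ z : Fin m → ℕ, y = z + Pi.single j 1 := by
      refine ⟨y - Pi.single j 1, funext fun l => ?_⟩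
      by_cases hl : l = j
      · subst hl
        simp
        omega
      · simp [Pi.single_eq_of_ne hl]
    refine ⟨z, fun k => ?_, ?_⟩
    · have h := hy k
      simp only [Pi.add_apply, mul_add, Finset.sum_add_distrib, Pi.single_apply, mul_ite, mul_one,
        mul_zero, Finset.sum_ite_eq', Finset.mem_univ, if_true] at h
      split_ifs at h with hk
      · subst hk
        omega
      · omega
    · simp [Finset.sum_add_distrib]

end Packing


/-- Max-Flow-Min-Cut is a finitely verifiable property: let `C` be a
clutter on `n` vertices with `m` edges and 0-1 incidence matrix `M` (each edge
nonempty, edges pairwise incomparable). For `c ∈ ℤ_{≥0}^n` set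
`γ(c) = min{c·x : x ∈ ℤ_{≥0}^n, Mᵀx ≥ 1_m}` and
`σ(c) = max{1_m·y : y ∈ ℤ_{≥0}^m, My ≤ c}`. If `γ(c) = σ(c)` for every `c` with
`c ≤ ⌈m/2⌉·(1,…,1)` componentwise, then `γ(c) = σ(c)` for every `c ∈ ℤ_{≥0}^n`,
i.e. `C` has the MFMC property. -/
theorem mfmc_of_packing_up_to_half (n m : ℕ)
    (M : Matrix (Fin n) (Fin m) ℕ)
    (hM : ∀ i j, M i j ≤ 1)
    (hedge : ∀ j, ∃ i, M i j = 1)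
    (hclutter : ∀ j j' : Fin m, (∀ i, M i j ≤ M i j') → j = j')
    (γ σ : (Fin n → ℕ) → ℕ)
    (hγ : ∀ c, γ c = sInf {v : ℕ | ∃ x : Fin n → ℕ,
      (∀ j, 1 ≤ ∑ i, M i j * x i) ∧ v = ∑ i, c i * x i})
    (hσ : ∀ c, σ c = sSup {v : ℕ | ∃ y : Fin m → ℕ,
      (∀ i, ∑ j, M i j * y j ≤ c i) ∧ v = ∑ j, y j})
    (h : ∀ c : Fin n → ℕ, (∀ i, c i ≤ ⌈(m : ℚ) / 2⌉₊) → γ c = σ c) :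
    ∀ c : Fin n → ℕ, γ c = σ c := by
  classical
  have hbdd : ∀ c : Fin n → ℕ, BddAbove {v : ℕ | ∃ y : Fin m → ℕ,
      (∀ i, ∑ j, M i j * y j ≤ c i) ∧ v = ∑ j, y j} := fun c =>
    ⟨∑ i, c i * (1 : Fin n → ℕ) i, by
      rintro _ ⟨y, hy, rfl⟩
      exact (isCover_one hedge).sum_le hy⟩
  have le_σ : ∀ {c : Fin n → ℕ} {y : Fin m → ℕ}, IsPacking M c y → ∑ j, y j ≤ σ c :=
      fun {c y} hy => by
    rw [hσ]
    exact le_csSup (hbdd c) ⟨y, hy, rfl⟩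
  have exists_σ : ∀ c, ∃ y, IsPacking M c y ∧ σ c = ∑ j, y j := fun c => by
    have hne : {v : ℕ | ∃ y : Fin m → ℕ,
        (∀ i, ∑ j, M i j * y j ≤ c i) ∧ v = ∑ j, y j}.Nonempty := ⟨0, 0, by simp, by simp⟩
    have hmem := Nat.sSup_mem hne (hbdd c)
    rwa [← hσ] at hmem
  have γ_le : ∀ {c : Fin n → ℕ} {x : Fin n → ℕ}, IsCover M x → γ c ≤ ∑ i, c i * x i :=
      fun {c x} hx => by
    rw [hγ]
    exact Nat.sInf_le ⟨x, hx, rfl⟩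
  have exists_γ : ∀ c, ∃ x, IsCover M x ∧ γ c = ∑ i, c i * x i := fun c => by
    have hne : {v : ℕ | ∃ x : Fin n → ℕ,
        (∀ j, 1 ≤ ∑ i, M i j * x i) ∧ v = ∑ i, c i * x i}.Nonempty :=
      ⟨_, 1, isCover_one hedge, rfl⟩
    have hmem := Nat.sInf_mem hne
    rwa [← hγ] at hmem
  have σ_add : ∀ a b, σ a + σ b ≤ σ (a + b) := fun a b => by
    obtain ⟨y, hy, hya⟩ := exists_σ a
    obtain ⟨z, hz, hzb⟩ := exists_σ b
    rw [hya, hzb, ← Finset.sum_add_distrib]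
    exact le_σ (hy.add hz)
  -- Halving a packing of `2c`: the odd part of the multiplicities is repacked by hypothesis.
  have σ_two : ∀ c, σ (2 • c) ≤ 2 * σ c := fun c => by
    obtain ⟨y, hy, hyc⟩ := exists_σ (2 • c)
    let a : Fin m → ℕ := fun j => y j / 2
    let r : Fin m → ℕ := fun j => y j % 2
    have hya : ∀ j, y j = 2 * a j + r j := fun j => (Nat.div_add_mod _ _).symm
    have hsum : ∑ j, y j = 2 * ∑ j, a j + ∑ j, r j := by
      simp only [hya, Finset.sum_add_distrib, Finset.mul_sum]
    have hrow : ∀ i, 2 * ∑ j, M i j * a j + ∑ j, M i j * r j ≤ 2 * c i := fun i => by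
      have e : 2 * ∑ j, M i j * a j + ∑ j, M i j * r j = ∑ j, M i j * y j := by
        rw [Finset.mul_sum, ← Finset.sum_add_distrib]
        exact Finset.sum_congr rfl fun j _ => by rw [hya j]; ring
      rw [e]
      simpa using hy i
    let c' : Fin n → ℕ := fun i => c i - ∑ j, M i j * a j
    have hr : IsPacking M (2 • c') r := fun i => by
      have := hrow i
      simp only [Pi.smul_apply, smul_eq_mul, c']
      omega
    have hceil : m ≤ 2 * ⌈(m : ℚ) / 2⌉₊ := by
      have h1 : (m : ℚ) / 2 ≤ ⌈(m : ℚ) / 2⌉₊ := Nat.le_ceil _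
      have h2 : (m : ℚ) ≤ 2 * ⌈(m : ℚ) / 2⌉₊ := by linarith
      exact_mod_cast h2
    have hrm : ∑ j, r j ≤ m := by
      calc ∑ j, r j ≤ ∑ _j : Fin m, 1 :=
            Finset.sum_le_sum fun j _ => Nat.le_of_lt_succ (Nat.mod_lt _ two_pos)
        _ = m := by simp
    generalize ⌈(m : ℚ) / 2⌉₊ = H at h hceil
    let b : Fin n → ℕ := fun i => min (c' i) H
    have hγb : ∑ j, r j ≤ 2 * γ b := by
      obtain ⟨x, hx, hxb⟩ := exists_γ b
      rw [hxb]
      by_cases hbig : ∃ i, x i ≠ 0 ∧ H ≤ c' i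
      · obtain ⟨i, hxi, hi⟩ := hbig
        have h1 : b i * x i ≤ ∑ i, b i * x i :=
          Finset.single_le_sum (f := fun i => b i * x i) (fun _ _ => Nat.zero_le _)
            (Finset.mem_univ i)
        have h2 : H ≤ b i * x i := by
          have : b i = H := min_eq_right hi
          rw [this]
          exact Nat.le_mul_of_pos_right _ (Nat.pos_of_ne_zero hxi)
        omega
      · push Not at hbig
        have e : ∑ i, b i * x i = ∑ i, c' i * x i := by
          refine Finset.sum_congr rfl fun i _ => ?_
          by_cases hxi : x i = 0
          · simp [hxi]
          · rw [show b i = c' i from min_eq_left (hbig i hxi).le]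
        rw [e, Finset.mul_sum]
        simpa [mul_assoc] using hx.sum_le hr
    rw [h b fun i => min_le_right _ _] at hγb
    obtain ⟨z, hz, hzb⟩ := exists_σ b
    have hpack : IsPacking M c (a + z) := fun i => by
      have h1 := hz i
      have h2 : b i ≤ c' i := min_le_left _ _
      have h3 := hrow i
      simp only [c'] at h2
      simp only [Pi.add_apply, mul_add, Finset.sum_add_distrib]
      omega
    have h1 := le_σ hpack
    simp only [Pi.add_apply, Finset.sum_add_distrib] at h1
    omega
  have σ_nsmul_le : ∀ (N : ℕ) a, N * σ a ≤ σ (N • a) := fun N a => by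
    induction N with
    | zero => simp
    | succ N ih =>
      have := σ_add (N • a) a
      rw [succ_nsmul]
      linarith
  have σ_pow : ∀ (k : ℕ) a, σ (2 ^ k • a) ≤ 2 ^ k * σ a := fun k a => by
    induction k with
    | zero => simp
    | succ k ih =>
      have := σ_two (2 ^ k • a)
      rw [pow_succ', mul_nsmul']
      linarith
  have hsuper : IsSuperlinear σ := by
    refine ⟨σ_add, fun N a => le_antisymm ?_ (σ_nsmul_le N a), fun b => ?_⟩
    · obtain ⟨k, hk⟩ := Nat.exists_eq_add_of_le (Nat.lt_two_pow_self (n := N)).le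
      have h1 := σ_pow N a
      have h2 := σ_add (N • a) (k • a)
      have h3 := σ_nsmul_le k a
      rw [← add_nsmul, ← hk] at h2
      rw [hk, add_mul, ← hk] at h1
      linarith
    · have hunit : ∀ i a, σ (a + Pi.single i 1) ≤ σ a + 1 := fun i a => by
        obtain ⟨y, hy, hya⟩ := exists_σ (a + Pi.single i 1)
        obtain ⟨z, hz, hyz⟩ := hy.exists_of_add_single hM
        have := le_σ hz
        omega
      rw [← Finset.univ_sum_single b]
      refine Finset.sum_induction _ (fun b => ∃ L, ∀ a, σ (a + b) ≤ σ a + L) ?_ ⟨0, by simp⟩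
        fun i _ => ⟨b i, ?_⟩
      · rintro b₁ b₂ ⟨L₁, h₁⟩ ⟨L₂, h₂⟩
        refine ⟨L₁ + L₂, fun a => ?_⟩
        have := h₁ a
        have := h₂ (a + b₁)
        rw [← add_assoc]
        omega
      · induction b i with
        | zero => simp
        | succ k ih =>
          intro a
          have := ih a
          have := hunit i (a + Pi.single i k)
          rw [Pi.single_add, ← add_assoc]
          omega
  intro c
  apply le_antisymm
  · obtain ⟨x, hx, hxc⟩ := hsuper.exists_linear_majorant c
    rw [hxc]
    refine γ_le fun j => le_trans ?_ (hx fun i => M i j)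
    have hcol : IsPacking M (fun i => M i j) (Pi.single j 1) := fun i => by
      simp [Pi.single_apply]
    simpa using le_σ hcol
  · obtain ⟨x, hx, hxc⟩ := exists_γ c
    obtain ⟨y, hy, hyc⟩ := exists_σ c
    rw [hxc, hyc]
    exact hx.sum_le hy
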